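/- Let F be a field of characteristic p with a discrete valuation v, and let λ ∈ F with v(λ − 1) = r, 0 < r < ∞. For every integer n > r, the minimum of the set {k ≥ 1 : v(λ^k − 1) ≥ n} equals p^⌈log_p(n/r)⌉, i.e. equals p^m where m is the least natural number with r·p^m ≥ n. -/

import Mathlib

lemma AddValuation.map_sub_one_le_map_pow_sub_one {F : Type*} [Field F]
    (v : AddValuation F (WithTop ℤ)) {x : F} (hx : 0 ≤ v x) (k : ℕ) :
    v (x - 1) ≤ v (x ^ k - 1) := by
  induction k with
  | zero => simp
  | succ k ih =>
    have h : x ^ (k + 1) - 1 = x * (x ^ k - 1) + (x - 1) := by ring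
    rw [h]
    refine v.map_le_add ?_ le_rfl
    rw [v.map_mul]
    exact ih.trans (le_add_of_nonneg_left hx)

lemma AddValuation.map_nonneg_of_map_sub_one_nonneg {F : Type*} [Field F]
    (v : AddValuation F (WithTop ℤ)) {x : F} (hx : 0 ≤ v (x - 1)) : 0 ≤ v x := by
  have h := v.map_le_add hx v.map_one.ge
  rwa [sub_add_cancel] at h

lemma AddValuation.map_pow_char_pow_sub_one {F : Type*} [Field F] (p : ℕ) [Fact p.Prime]
    [CharP F p] (v : AddValuation F (WithTop ℤ)) {x : F} {r : ℤ}
    (hv : v (x - 1) = (r : WithTop ℤ)) (m : ℕ) :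
    v (x ^ p ^ m - 1) = ((r * p ^ m : ℤ) : WithTop ℤ) := by
  have h : x ^ p ^ m - 1 = (x - 1) ^ p ^ m := by rw [sub_pow_char_pow, one_pow]
  rw [h, v.map_pow, hv, ← WithTop.coe_nsmul, nsmul_eq_mul, mul_comm]
  push_cast
  rfl

lemma AddValuation.map_pow_sub_one_le_of_not_dvd {F : Type*} [Field F] (p : ℕ) [Fact p.Prime]
    [CharP F p] (v : AddValuation F (WithTop ℤ)) {x : F} {r : ℤ} (hr : 0 < r)
    (hv : v (x - 1) = (r : WithTop ℤ)) {k : ℕ} (hk : ¬ p ∣ k) :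
    v (x ^ k - 1) ≤ (r : WithTop ℤ) := by
  have hp : p.Prime := Fact.out
  have nonneg_of {y : F} (hy : (r : WithTop ℤ) ≤ v (y - 1)) : 0 ≤ v y :=
    v.map_nonneg_of_map_sub_one_nonneg (le_trans (by exact_mod_cast hr.le) hy)
  have hx : 0 ≤ v x := nonneg_of hv.ge
  obtain ⟨j, hj⟩ := Nat.exists_mul_mod_eq_one_of_coprime
    ((hp.coprime_iff_not_dvd.2 hk).symm) hp.one_lt
  have hkj : k * j = p * (k * j / p) + 1 := by rw [← hj.2, Nat.div_add_mod]
  set t := k * j / p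
  have hpow := v.map_sub_one_le_map_pow_sub_one (x := x ^ k)
    (nonneg_of (hv ▸ v.map_sub_one_le_map_pow_sub_one hx k)) j
  have hxp : v (x ^ p - 1) = ((r * p : ℤ) : WithTop ℤ) := by
    simpa using v.map_pow_char_pow_sub_one p hv 1
  have hlt : (r : WithTop ℤ) < v (x ^ p - 1) := by
    rw [hxp]
    have : (1 : ℤ) < p := by exact_mod_cast hp.one_lt
    exact_mod_cast (by nlinarith : r < r * p)
  have hlt' : v (x - 1) < v (x * ((x ^ p) ^ t - 1)) := by
    rw [hv, v.map_mul]
    exact (hlt.trans_le (v.map_sub_one_le_map_pow_sub_one (nonneg_of hlt.le) t)).trans_le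
      (le_add_of_nonneg_left hx)
  have h : (x ^ k) ^ j - 1 = (x - 1) + x * ((x ^ p) ^ t - 1) := by
    rw [← pow_mul, hkj, pow_succ, pow_mul]
    ring
  rwa [h, v.map_add_eq_of_lt_left hlt', hv] at hpow


/-- If `v(λ - 1) = r` with `0 < r < ∞` in characteristic `p`, then for `n > r`,
`min {k ≥ 1 : v(λ^k - 1) ≥ n} = p^m` where `m` is least with `r·p^m ≥ n`. -/
theorem stmt2 (F : Type*) [Field F] (p : ℕ) [Fact p.Prime] [CharP F p]
    (v : AddValuation F (WithTop ℤ)) (lam : F) (r : ℤ) (hr : 0 < r)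
    (hv : v (lam - 1) = (r : WithTop ℤ)) (n : ℤ) (hn : r < n) :
    sInf {k : ℕ | 0 < k ∧ (n : WithTop ℤ) ≤ v (lam ^ k - 1)} =
      p ^ sInf {m : ℕ | n ≤ r * p ^ m} := by
  have hp : p.Prime := Fact.out
  have hne : {m : ℕ | n ≤ r * p ^ m}.Nonempty := by
    obtain ⟨m, hm⟩ := pow_unbounded_of_one_lt n (by exact_mod_cast hp.one_lt : (1 : ℤ) < p)
    have : (0 : ℤ) < p ^ m := pow_pos (by exact_mod_cast hp.pos) m
    exact ⟨m, show n ≤ r * p ^ m by nlinarith⟩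
  have hmem := Nat.sInf_mem hne
  have hmin : ∀ a < sInf {m : ℕ | n ≤ r * p ^ m}, r * p ^ a < n :=
    fun a ha => not_le.1 (Nat.notMem_of_lt_sInf ha)
  generalize sInf {m : ℕ | n ≤ r * p ^ m} = m at hmem hmin
  refine IsLeast.csInf_eq ⟨⟨pow_pos hp.pos m, ?_⟩, fun k ⟨hk, hnk⟩ => ?_⟩
  · rw [v.map_pow_char_pow_sub_one p hv]
    exact_mod_cast hmem
  · by_contra! hkm
    obtain ⟨a, k', hk', rfl⟩ := Nat.exists_eq_pow_mul_and_not_dvd hk.ne' p hp.ne_one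
    have ham : a < m := (Nat.pow_lt_pow_iff_right hp.one_lt).1
      ((Nat.le_of_dvd hk (dvd_mul_right _ _)).trans_lt hkm)
    have hle := v.map_pow_sub_one_le_of_not_dvd p
      (mul_pos hr (pow_pos (by exact_mod_cast hp.pos) a))
      (v.map_pow_char_pow_sub_one p hv a) hk'
    rw [← pow_mul] at hle
    exact (hmin a ham).not_ge (by exact_mod_cast hnk.trans hle)
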